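/- (Dominant property of the super-energy tensor of a one-form, equation (6) of the paper for r = 1.) Let n ≥ 2 and let s be any vector of n-dimensional Minkowski vector space. Then the bilinear form S(u, v) = η s u * η s v - (1/2) * η s s * η u v has the dominant property: S(u, v) ≥ 0 for all u, v ∈ Θ⁺. -/

import Mathlib

namespace PaperCausal

variable {n : ℕ}

/-- The Lorentzian (Minkowski) bilinear form on `Fin n → ℝ`:
`η x y = x 0 * y 0 - ∑_{i ≠ 0} x i * y i`. -/
noncomputable def eta [NeZero n] (x y : Fin n → ℝ) : ℝ :=
  x 0 * y 0 - ∑ i ∈ Finset.univ.filter (fun i => i ≠ (0 : Fin n)), x i * y i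

/-- `x ∈ Θ⁺`: future-directed causal vector. -/
def FutureCausal [NeZero n] (x : Fin n → ℝ) : Prop :=
  0 ≤ eta x x ∧ 0 < x 0

/-- Future-directed null vector. -/
def FutureNull [NeZero n] (x : Fin n → ℝ) : Prop :=
  eta x x = 0 ∧ 0 < x 0

/-- Future-directed timelike vector. -/
def FutureTimelike [NeZero n] (x : Fin n → ℝ) : Prop :=
  0 < eta x x ∧ 0 < x 0

/-- The dominant property `T ∈ DP⁺_r` for an `r`-multilinear map. -/
def DPplus [NeZero n] {r : ℕ} (T : MultilinearMap ℝ (fun _ : Fin r => (Fin n → ℝ)) ℝ) : Prop :=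
  ∀ v : Fin r → (Fin n → ℝ), (∀ i, FutureCausal (v i)) → 0 ≤ T v

/-- The dominant property `T ∈ DP⁺_2` for a bilinear form. -/
def DP2 [NeZero n] (T : (Fin n → ℝ) →ₗ[ℝ] (Fin n → ℝ) →ₗ[ℝ] ℝ) : Prop :=
  ∀ u v : Fin n → ℝ, FutureCausal u → FutureCausal v → 0 ≤ T u v

lemma eta_comm [NeZero n] (x y : Fin n → ℝ) : eta x y = eta y x := by
  simp only [eta, mul_comm]

lemma eta_sub_left [NeZero n] (x y z : Fin n → ℝ) : eta (x - y) z = eta x z - eta y z := by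
  simp only [eta, Pi.sub_apply, sub_mul, Finset.sum_sub_distrib]
  ring

lemma eta_smul_left [NeZero n] (c : ℝ) (x y : Fin n → ℝ) : eta (c • x) y = c * eta x y := by
  simp only [eta, Pi.smul_apply, smul_eq_mul, mul_assoc, ← Finset.mul_sum]
  ring

/-- Cauchy–Schwarz for the spatial parts, written through `eta`. -/
lemma sq_time_mul_sub_eta_le [NeZero n] (x y : Fin n → ℝ) :
    (x 0 * y 0 - eta x y) ^ 2 ≤ (x 0 ^ 2 - eta x x) * (y 0 ^ 2 - eta y y) := by
  have h := Finset.sum_mul_sq_le_sq_mul_sq (Finset.univ.filter (fun i => i ≠ (0 : Fin n))) x y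
  simpa only [eta, ← sq, sub_sub_cancel] using h

lemma time_sq_sub_eta_nonneg [NeZero n] (x : Fin n → ℝ) : 0 ≤ x 0 ^ 2 - eta x x := by
  simp only [eta, ← sq, sub_sub_cancel]
  positivity

lemma eta_nonneg_of_causal [NeZero n] {x y : Fin n → ℝ} (hx : 0 ≤ eta x x) (hx0 : 0 ≤ x 0)
    (hy : 0 ≤ eta y y) (hy0 : 0 ≤ y 0) : 0 ≤ eta x y := by
  have h : (x 0 * y 0 - eta x y) ^ 2 ≤ (x 0 * y 0) ^ 2 := by
    rw [mul_pow]
    exact (sq_time_mul_sub_eta_le x y).trans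
      (mul_le_mul (by linarith) (by linarith) (time_sq_sub_eta_nonneg y) (sq_nonneg _))
  have := abs_le_of_sq_le_sq' h (mul_nonneg hx0 hy0)
  linarith

lemma reflection_time_nonneg [NeZero n] (s : Fin n → ℝ) {u : Fin n → ℝ} (hu : 0 ≤ eta u u)
    (hu0 : 0 ≤ u 0) : 0 ≤ 2 * eta s u * s 0 - eta s s * u 0 := by
  have hs := time_sq_sub_eta_nonneg s
  have hcs : (s 0 * u 0 - eta s u) ^ 2 ≤ (s 0 ^ 2 - eta s s) * u 0 ^ 2 :=
    (sq_time_mul_sub_eta_le s u).trans (mul_le_mul_of_nonneg_left (by linarith) hs)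
  have h : (2 * s 0 * (s 0 * u 0 - eta s u)) ^ 2 ≤ ((s 0 ^ 2 + (s 0 ^ 2 - eta s s)) * u 0) ^ 2 := by
    have h1 := mul_le_mul_of_nonneg_left hcs (by positivity : 0 ≤ 4 * s 0 ^ 2)
    have h2 := sq_nonneg ((s 0 ^ 2 - (s 0 ^ 2 - eta s s)) * u 0)
    linarith
  have := abs_le_of_sq_le_sq' h (mul_nonneg (by positivity) hu0)
  linarith

theorem superenergy_dominant (n : ℕ) [NeZero n] (hn : 2 ≤ n) (s : Fin n → ℝ) :
    ∀ u v : Fin n → ℝ, FutureCausal u → FutureCausal v →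
      0 ≤ eta s u * eta s v - (1 / 2) * eta s s * eta u v := by
  intro u v hu hv
  set p : Fin n → ℝ := (2 * eta s u) • s - eta s s • u with hp
  have hpx (x : Fin n → ℝ) : eta p x = 2 * eta s u * eta s x - eta s s * eta u x := by
    rw [hp, eta_sub_left, eta_smul_left, eta_smul_left]
  have hpp : eta p p = eta s s ^ 2 * eta u u := by
    rw [hpx, eta_comm s p, eta_comm u p, hpx, hpx, eta_comm u s]
    ring
  have hp0 : 0 ≤ p 0 := reflection_time_nonneg s hu.1 hu.2.le
  have h := eta_nonneg_of_causal (hpp ▸ mul_nonneg (sq_nonneg _) hu.1) hp0 hv.1 hv.2.le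
  rw [hpx] at h
  linarith

end PaperCausal
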